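/- Let U : ℝ^n → ℝ be a C² function bounded above, let k > sup U := sSup(range U), and let x₋, x₊ ∈ ℝ^n with x₋ ≠ x₊. Then there exist T* > 0 and a C¹ curve γ* : [0,T*] → ℝ^n with γ*(0) = x₋, γ*(T*) = x₊ such that for every T > 0 and every C¹ curve γ : [0,T] → ℝ^n with γ(0) = x₋ and γ(T) = x₊, ∫₀^{T*} ( (1/2)|γ̇*(t)|² − U(γ*(t)) + k ) dt ≤ ∫₀^T ( (1/2)|γ̇(t)|² − U(γ(t)) + k ) dt. In other words, for every energy parameter k above the Mañé critical value, the free-time action admits a global minimizer. -/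

import Mathlib

open MeasureTheory intervalIntegral Filter Topology

theorem ftm_abstract {H Y : Type*} [NormedAddCommGroup H] [InnerProductSpace ℝ H] [CompleteSpace H]
    [NormedAddCommGroup Y] [NormedSpace ℝ Y] (K : H →L[ℝ] Y) (F : H → ℝ) (c : ℝ) (hc : 0 < c)
    (hF : ∀ w, c ≤ F w)
    (hL : ∀ R : ℝ, ∃ L : ℝ, 0 ≤ L ∧ ∀ w w', ‖w‖ ≤ R → ‖w'‖ ≤ R → |F w - F w'| ≤ L * ‖K w - K w'‖)
    (hK : ∀ R : ℝ, IsCompact (closure (K '' Metric.closedBall 0 R)))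
    (S : Set H) (hS : IsClosed S) (hSc : Convex ℝ S) (hSn : S.Nonempty) :
    ∃ w ∈ S, ∀ w' ∈ S, ‖w‖ ^ 2 * F w ≤ ‖w'‖ ^ 2 * F w' := by
  set J : H → ℝ := fun w => ‖w‖ ^ 2 * F w with hJ
  have hJ0 : ∀ w, 0 ≤ J w := fun w => mul_nonneg (sq_nonneg _) (hc.le.trans (hF w))
  have hbdd : BddBelow (J '' S) := ⟨0, by rintro _ ⟨w, _, rfl⟩; exact hJ0 w⟩
  obtain ⟨u, hanti, hu, huS⟩ := exists_seq_tendsto_sInf (hSn.image J) hbdd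
  set m := sInf (J '' S) with hm
  have hmle : ∀ w ∈ S, m ≤ J w := fun w hw => csInf_le hbdd ⟨w, hw, rfl⟩
  choose v hvS hvu using huS
  have hm0 : 0 ≤ m := le_csInf (hSn.image J) (by rintro _ ⟨w, _, rfl⟩; exact hJ0 w)
  -- bounded
  set R : ℝ := u 0 / c + 1 with hR
  have hvR : ∀ i, ‖v i‖ ≤ R := by
    intro i
    have h1 : J (v i) ≤ u 0 := by rw [hvu]; exact hanti (Nat.zero_le i)
    have h2 : ‖v i‖ ^ 2 * c ≤ J (v i) := mul_le_mul_of_nonneg_left (hF _) (sq_nonneg _)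
    have h3 : ‖v i‖ ^ 2 ≤ u 0 / c := by rw [le_div_iff₀ hc]; linarith
    have : ‖v i‖ ≤ ‖v i‖ ^ 2 + 1 := by nlinarith [sq_nonneg (‖v i‖ - 1)]
    linarith
  obtain ⟨L, hL0, hL⟩ := hL R
  obtain ⟨g, -, φ, hφ, hg⟩ := (hK R).tendsto_subseq (x := fun i => K (v i)) (fun i =>
    subset_closure ⟨v i, by simpa using hvR i, rfl⟩)
  set z : ℕ → H := fun i => v (φ i) with hz
  have hg' : Tendsto (fun i => K (z i)) atTop (𝓝 g) := hg
  have hzR : ∀ i, ‖z i‖ ≤ R := fun i => hvR _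
  have hJz : Tendsto (fun i => J (z i)) atTop (𝓝 m) := by
    have := hu.comp hφ.tendsto_atTop
    refine this.congr fun i => ?_
    simp [hz, hvu]
  have hKc : Tendsto (fun p : ℕ × ℕ => ‖K (z p.1) - K (z p.2)‖) atTop (𝓝 0) := by
    have := cauchySeq_iff_tendsto_dist_atTop_0.1 hg'.cauchySeq
    simpa [dist_eq_norm] using this
  have hFc : CauchySeq (fun i => F (z i)) := by
    rw [cauchySeq_iff_tendsto_dist_atTop_0]
    refine squeeze_zero (fun _ => dist_nonneg) (fun p => ?_) (by simpa using hKc.const_mul L)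
    rw [Real.dist_eq]
    exact hL _ _ (hzR _) (hzR _)
  obtain ⟨Fi, hFi⟩ := cauchySeq_tendsto_of_complete hFc
  have hFi0 : c ≤ Fi := ge_of_tendsto' hFi fun i => hF _
  have hFip : 0 < Fi := hc.trans_le hFi0
  have hN : Tendsto (fun i => ‖z i‖ ^ 2) atTop (𝓝 (m / Fi)) := by
    refine (hJz.div hFi hFip.ne').congr fun i => ?_
    have := hc.trans_le (hF (z i))
    simp only [hJ, Pi.div_apply]
    field_simp
  have h1 : Tendsto (fun p : ℕ × ℕ => p.1) atTop atTop := by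
    rw [← prod_atTop_atTop_eq]; exact tendsto_fst
  have h2 : Tendsto (fun p : ℕ × ℕ => p.2) atTop atTop := by
    rw [← prod_atTop_atTop_eq]; exact tendsto_snd
  let md : ℕ × ℕ → H := fun p => (1/2:ℝ) • z p.1 + (1/2:ℝ) • z p.2
  have hmdS : ∀ p, md p ∈ S := fun p =>
    hSc (hvS _) (hvS _) (by norm_num) (by norm_num) (by norm_num)
  have hmdR : ∀ p, ‖md p‖ ≤ R := fun p => by
    have : md p ∈ Metric.closedBall (0:H) R :=
      (convex_closedBall (0:H) R) (by simpa using hzR _) (by simpa using hzR _) (by norm_num) (by norm_num) (by norm_num)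
    simpa using this
  have hFmd : Tendsto (fun p => F (md p)) atTop (𝓝 Fi) := by
    have hd : Tendsto (fun p => F (md p) - F (z p.1)) atTop (𝓝 0) := by
      rw [tendsto_zero_iff_norm_tendsto_zero]
      refine squeeze_zero (fun _ => norm_nonneg _) (fun p => ?_) (by simpa using hKc.const_mul L)
      rw [Real.norm_eq_abs]
      refine (hL _ _ (hmdR p) (hzR _)).trans (mul_le_mul_of_nonneg_left ?_ hL0)
      rw [← map_sub, ← map_sub]
      have : md p - z p.1 = (-(1/2):ℝ) • (z p.1 - z p.2) := by
        simp only [md]; module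
      rw [this, map_smul, norm_smul]
      have := norm_nonneg (K (z p.1) - K (z p.2))
      norm_num
      linarith
    have := hd.add (hFi.comp h1)
    simpa using this
  have hzc : CauchySeq z := by
    rw [cauchySeq_iff_tendsto_dist_atTop_0]
    have key : ∀ p : ℕ × ℕ, (dist (z p.1) (z p.2)) ^ 2 ≤
        2 * ‖z p.1‖ ^ 2 + 2 * ‖z p.2‖ ^ 2 - 4 * (m / F (md p)) := by
      intro p
      have hp := parallelogram_law_with_norm ℝ (z p.1) (z p.2)
      have e : z p.1 + z p.2 = (2:ℝ) • md p := by simp only [md]; module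
      have hq : m / F (md p) ≤ ‖md p‖ ^ 2 := by
        rw [div_le_iff₀ (hc.trans_le (hF _))]; exact hmle _ (hmdS p)
      rw [e, norm_smul] at hp
      rw [dist_eq_norm]
      norm_num at hp
      nlinarith
    have ht : Tendsto (fun p : ℕ × ℕ => 2 * ‖z p.1‖ ^ 2 + 2 * ‖z p.2‖ ^ 2 - 4 * (m / F (md p)))
        atTop (𝓝 0) := by
      have := (((hN.comp h1).const_mul 2).add ((hN.comp h2).const_mul 2)).sub
        (((tendsto_const_nhds (x := m)).div hFmd hFip.ne').const_mul 4)
      have e : (0:ℝ) = 2 * (m / Fi) + 2 * (m / Fi) - 4 * (m / Fi) := by ring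
      rw [e]
      exact this
    have hsq := squeeze_zero (fun p => sq_nonneg _) key ht
    have := hsq.sqrt
    simpa [Real.sqrt_sq dist_nonneg] using this
  obtain ⟨w, hw⟩ := cauchySeq_tendsto_of_complete hzc
  have hwS : w ∈ S := hS.mem_of_tendsto hw (Eventually.of_forall fun i => hvS _)
  have hwR : ‖w‖ ≤ R := le_of_tendsto' hw.norm hzR
  have hFw : Tendsto (fun i => F (z i)) atTop (𝓝 (F w)) := by
    rw [tendsto_iff_norm_sub_tendsto_zero]
    have hk : Tendsto (fun i => ‖K (z i) - K w‖) atTop (𝓝 0) := by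
      rw [← tendsto_iff_norm_sub_tendsto_zero]
      exact (K.continuous.tendsto w).comp hw
    exact squeeze_zero (fun _ => norm_nonneg _) (fun i => hL _ _ (hzR i) hwR) (by simpa using hk.const_mul L)
  have hJw : J w = m := tendsto_nhds_unique ((hw.norm.pow 2).mul hFw) hJz
  exact ⟨w, hwS, fun w' hw' => by
    have := hmle w' hw'
    rw [← hJw] at this
    exact this⟩

set_option linter.unusedSectionVars false

noncomputable section FTM

abbrev ftmMu : Measure ℝ := volume.restrict (Set.Ioc (0:ℝ) 1)

variable {E : Type*} [NormedAddCommGroup E] [InnerProductSpace ℝ E] [FiniteDimensional ℝ E]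

/-- primitive -/
def ftmK (w : Lp E 2 ftmMu) (t : ℝ) : E := ∫ x in Set.Iic t, w x ∂ftmMu

theorem ftm_int (w : Lp E 2 ftmMu) : Integrable w ftmMu :=
  (Lp.memLp w).integrable (by norm_num)

theorem ftmK_sub (w : Lp E 2 ftmMu) {s t : ℝ} (h : s ≤ t) :
    ftmK w t - ftmK w s = ∫ x in Set.Ioc s t, w x ∂ftmMu := by
  rw [ftmK, ftmK, integral_Iic_sub_Iic (ftm_int w).integrableOn (ftm_int w).integrableOn,
    integral_of_le h]

theorem ftmMu_real (s t : ℝ) (h : s ≤ t) : ftmMu.real (Set.Ioc s t) ≤ t - s := by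
  calc ftmMu.real (Set.Ioc s t) ≤ volume.real (Set.Ioc s t) :=
        ENNReal.toReal_mono (by simp) (Measure.restrict_apply_le _ _)
    _ = t - s := by simp [h]

theorem ftm_holder (w : Lp E 2 ftmMu) {s t : ℝ} (h : s ≤ t) :
    ‖∫ x in Set.Ioc s t, w x ∂ftmMu‖ ≤ √(t - s) * ‖w‖ := by
  set a := ∫ x in Set.Ioc s t, w x ∂ftmMu with ha
  have h1 := L2.inner_indicatorConstLp_eq_inner_setIntegral ℝ (μ := ftmMu)
    (measurableSet_Ioc (a := s) (b := t)) (measure_ne_top _ _) a w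
  rw [← ha, real_inner_self_eq_norm_sq] at h1
  have h2 := real_inner_le_norm (indicatorConstLp 2 (μ := ftmMu)
    (measurableSet_Ioc (a := s) (b := t)) (measure_ne_top _ _) a) w
  rw [h1, norm_indicatorConstLp (by norm_num) (by norm_num)] at h2
  have h3 : ftmMu.real (Set.Ioc s t) ^ (1 / (2:ENNReal).toReal) ≤ √(t - s) := by
    rw [Real.sqrt_eq_rpow]
    rw [ENNReal.toReal_ofNat]
    exact Real.rpow_le_rpow measureReal_nonneg (ftmMu_real s t h) (by norm_num)
  rcases eq_or_lt_of_le (norm_nonneg a) with h0 | h0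
  · rw [← h0]; positivity
  · have : ‖a‖ * ‖a‖ ≤ ‖a‖ * (√(t - s) * ‖w‖) := by
      calc ‖a‖ * ‖a‖ = ‖a‖ ^ 2 := by ring
        _ ≤ _ := h2
        _ ≤ ‖a‖ * √(t - s) * ‖w‖ := by gcongr
        _ = _ := by ring
    exact le_of_mul_le_mul_left this h0

theorem ftmK_dist (w : Lp E 2 ftmMu) (s t : ℝ) :
    ‖ftmK w t - ftmK w s‖ ≤ √|t - s| * ‖w‖ := by
  rcases le_total s t with h | h
  · rw [ftmK_sub w h, abs_of_nonneg (by linarith)]; exact ftm_holder w h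
  · rw [norm_sub_rev, ftmK_sub w h, abs_of_nonpos (by linarith), neg_sub]; exact ftm_holder w h

theorem ftmK_zero (w : Lp E 2 ftmMu) : ftmK w 0 = 0 := by
  rw [ftmK, Measure.restrict_restrict measurableSet_Iic]
  have : Set.Iic (0:ℝ) ∩ Set.Ioc 0 1 = ∅ := by
    ext x; simp only [Set.mem_inter_iff, Set.mem_Iic, Set.mem_Ioc, Set.mem_empty_iff_false]
    grind
  simp [this]

theorem ftmK_norm (w : Lp E 2 ftmMu) {t : ℝ} (ht : t ∈ Set.Icc (0:ℝ) 1) : ‖ftmK w t‖ ≤ ‖w‖ := by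
  have := ftmK_dist w 0 t
  rw [ftmK_zero, sub_zero, sub_zero, abs_of_nonneg ht.1] at this
  refine this.trans (mul_le_of_le_one_left (norm_nonneg _) ?_)
  exact Real.sqrt_le_one.2 ht.2

theorem ftmK_cont (w : Lp E 2 ftmMu) : Continuous (ftmK w) := by
  rw [continuous_iff_continuousAt]
  intro s
  rw [ContinuousAt, tendsto_iff_norm_sub_tendsto_zero]
  refine squeeze_zero (fun _ => norm_nonneg _) (fun t => ftmK_dist w s t) ?_
  have : Continuous fun t : ℝ => √|t - s| * ‖w‖ := by fun_prop
  simpa using this.tendsto s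

theorem ftmK_add (w w' : Lp E 2 ftmMu) (t : ℝ) : ftmK (w + w') t = ftmK w t + ftmK w' t := by
  rw [ftmK, ftmK, ftmK, ← integral_add (ftm_int w).integrableOn (ftm_int w').integrableOn]
  exact integral_congr_ae (ae_restrict_of_ae (Lp.coeFn_add w w'))

theorem ftmK_smul (c : ℝ) (w : Lp E 2 ftmMu) (t : ℝ) : ftmK (c • w) t = c • ftmK w t := by
  rw [ftmK, ftmK, ← MeasureTheory.integral_smul]
  exact integral_congr_ae (ae_restrict_of_ae (Lp.coeFn_smul c w))

theorem ftmK_sub' (w w' : Lp E 2 ftmMu) (t : ℝ) : ftmK (w - w') t = ftmK w t - ftmK w' t := by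
  have : w - w' = w + (-1:ℝ) • w' := by module
  rw [this, ftmK_add, ftmK_smul]; module

def ftmKL : Lp E 2 ftmMu →L[ℝ] BoundedContinuousFunction (Set.Icc (0:ℝ) 1) E :=
  LinearMap.mkContinuous
    { toFun := fun w => BoundedContinuousFunction.mkOfCompact
        ⟨fun t => ftmK w t, (ftmK_cont w).comp continuous_subtype_val⟩
      map_add' := fun w w' => by ext t; simp [ftmK_add]
      map_smul' := fun c w => by ext t; simp [ftmK_smul] } 1
    (fun w => by
      rw [one_mul, BoundedContinuousFunction.norm_le (norm_nonneg _)]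
      intro t
      exact ftmK_norm w t.2)

theorem ftmKL_apply (w : Lp E 2 ftmMu) (t : Set.Icc (0:ℝ) 1) : ftmKL w t = ftmK w t := rfl

theorem ftmKL_compact (R : ℝ) :
    IsCompact (closure ((ftmKL (E := E)) '' Metric.closedBall 0 R)) := by
  refine BoundedContinuousFunction.arzela_ascoli (Metric.closedBall (0:E) R)
    (isCompact_closedBall _ _) _ ?_ ?_
  · rintro _ t ⟨w, hw, rfl⟩
    rw [mem_closedBall_zero_iff] at hw ⊢
    exact (ftmK_norm w t.2).trans hw
  · refine Metric.equicontinuous_of_continuity_modulus (fun d => √|d| * R) ?_ _ ?_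
    · have : Continuous fun t : ℝ => √|t| * R := by fun_prop
      simpa using this.tendsto 0
    · rintro s t ⟨_, w, hw, rfl⟩
      rw [mem_closedBall_zero_iff] at hw
      have := ftmK_dist w t s
      rw [dist_eq_norm]
      refine this.trans ?_
      rw [Subtype.dist_eq, Real.dist_eq, abs_abs]
      gcongr

/-- potential part -/
def ftmF (f : E → ℝ) (x0 : E) (w : Lp E 2 ftmMu) : ℝ := ∫ t in (0:ℝ)..1, f (x0 + ftmK w t)

theorem ftmF_lip (f : E → ℝ) (hf : ContDiff ℝ 1 f) (x0 : E) (R : ℝ) :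
    ∃ L : ℝ, 0 ≤ L ∧ ∀ w w' : Lp E 2 ftmMu, ‖w‖ ≤ R → ‖w'‖ ≤ R →
      |ftmF f x0 w - ftmF f x0 w'| ≤ L * ∫ t in (0:ℝ)..1, ‖ftmK w t - ftmK w' t‖ := by
  obtain ⟨L, hL⟩ := LocallyLipschitzOn.exists_lipschitzOnWith_of_compact
    (isCompact_closedBall x0 R) (hf.locallyLipschitz.locallyLipschitzOn)
  refine ⟨L, L.2, fun w w' hw hw' => ?_⟩
  have c1 : ∀ w : Lp E 2 ftmMu, Continuous fun t => f (x0 + ftmK w t) := fun w =>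
    hf.continuous.comp (continuous_const.add (ftmK_cont w))
  have c2 : Continuous fun t => ‖ftmK w t - ftmK w' t‖ := ((ftmK_cont w).sub (ftmK_cont w')).norm
  rw [ftmF, ftmF, ← integral_sub ((c1 w).intervalIntegrable _ _) ((c1 w').intervalIntegrable _ _),
    ← Real.norm_eq_abs, ← intervalIntegral.integral_const_mul]
  refine intervalIntegral.norm_integral_le_of_norm_le zero_le_one ?_
    ((continuous_const.mul c2).intervalIntegrable _ _)
  refine Eventually.of_forall fun t ht => ?_
  have ht' : t ∈ Set.Icc (0:ℝ) 1 := ⟨ht.1.le, ht.2⟩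
  have := hL.norm_sub_le (x := x0 + ftmK w t) (y := x0 + ftmK w' t)
    (by simpa [Metric.mem_closedBall, dist_eq_norm] using (ftmK_norm w ht').trans hw)
    (by simpa [Metric.mem_closedBall, dist_eq_norm] using (ftmK_norm w' ht').trans hw')
  simpa using this

theorem ftm_exists (f : E → ℝ) (hf : ContDiff ℝ 1 f) (x0 d : E) (c : ℝ) (hc : 0 < c)
    (hfc : ∀ x, c ≤ f x) :
    ∃ w : Lp E 2 ftmMu, ftmK w 1 = d ∧ ∀ w' : Lp E 2 ftmMu, ftmK w' 1 = d →
      ‖w‖ ^ 2 * ftmF f x0 w ≤ ‖w'‖ ^ 2 * ftmF f x0 w' := by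
  have h1 : (1:ℝ) ∈ Set.Icc (0:ℝ) 1 := by simp
  refine ftm_abstract (ftmKL (E := E)) (ftmF f x0) c hc ?_ ?_ ftmKL_compact
    {w | ftmK w 1 = d} ?_ ?_ ?_
  · intro w
    have : ∫ t in (0:ℝ)..1, c ≤ ftmF f x0 w :=
      integral_mono_on zero_le_one (by simp)
        ((hf.continuous.comp (continuous_const.add (ftmK_cont w))).intervalIntegrable _ _)
        (fun t _ => hfc _)
    simpa using this
  · intro R
    obtain ⟨L, hL0, hL⟩ := ftmF_lip f hf x0 R
    refine ⟨L, hL0, fun w w' hw hw' => (hL w w' hw hw').trans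
      (mul_le_mul_of_nonneg_left ?_ hL0)⟩
    have : ∫ t in (0:ℝ)..1, ‖ftmK w t - ftmK w' t‖ ≤ ∫ t in (0:ℝ)..1, ‖ftmKL w - ftmKL w'‖ := by
      refine integral_mono_on zero_le_one
        (((ftmK_cont w).sub (ftmK_cont w')).norm.intervalIntegrable _ _) (by simp) ?_
      intro t ht
      exact (ftmKL w - ftmKL w').norm_coe_le_norm ⟨t, ht⟩
    simpa using this
  · have : Continuous fun w : Lp E 2 ftmMu => ftmKL w ⟨1, h1⟩ :=
      (continuous_eval_const (⟨1, h1⟩ : Set.Icc (0:ℝ) 1)).comp ftmKL.continuous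
    exact isClosed_eq this continuous_const
  · intro w hw w' hw' a b _ _ hab
    simp only [Set.mem_ofPred_eq] at *
    rw [ftmK_add, ftmK_smul, ftmK_smul, hw, hw', ← add_smul, hab, one_smul]
  · refine ⟨indicatorConstLp 2 (μ := ftmMu) MeasurableSet.univ (measure_ne_top _ _) d, ?_⟩
    simp only [Set.mem_ofPred_eq]
    rw [ftmK, setIntegral_indicatorConstLp measurableSet_Iic]
    have : Set.Iic (1:ℝ) ∩ Set.Ioc 0 1 = Set.Ioc 0 1 := by grind
    simp [measureReal_def, Measure.restrict_apply, this]

theorem ftm_EL (f : E → ℝ) (hf : ContDiff ℝ 1 f) (x0 d : E) (w : Lp E 2 ftmMu)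
    (hF : 0 < ftmF f x0 w) (hw : ftmK w 1 = d)
    (hmin : ∀ w' : Lp E 2 ftmMu, ftmK w' 1 = d →
      ‖w‖ ^ 2 * ftmF f x0 w ≤ ‖w'‖ ^ 2 * ftmF f x0 w') :
    ∃ C : ℝ, 0 ≤ C ∧ ∀ h : Lp E 2 ftmMu, ftmK h 1 = 0 →
      - inner ℝ w h ≤ C * ∫ t in (0:ℝ)..1, ‖ftmK h t‖ := by
  obtain ⟨L, hL0, hL⟩ := ftmF_lip f hf x0 (‖w‖ + 1)
  refine ⟨L * ‖w‖ ^ 2 / (2 * ftmF f x0 w), by positivity, fun h hh => ?_⟩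
  set I := ∫ t in (0:ℝ)..1, ‖ftmK h t‖ with hI
  set N := ‖w‖ ^ 2
  set F := ftmF f x0 w
  set b := inner ℝ w h with hb
  set q := ‖h‖ ^ 2
  have key : ∀ᶠ ε in 𝓝[>] (0:ℝ),
      0 ≤ 2 * b * F + L * I * N + ε * (q * F + 2 * L * I * b + ε * (L * I * q)) := by
    have hev : ∀ᶠ ε in 𝓝[>] (0:ℝ), ε < 1 / (‖h‖ + 1) :=
      (eventually_lt_nhds (by positivity)).filter_mono nhdsWithin_le_nhds
    filter_upwards [hev, self_mem_nhdsWithin] with ε h1 h0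
    have h0 : 0 < ε := h0
    have h2 : ‖ε • h‖ ≤ 1 := by
      rw [norm_smul, Real.norm_of_nonneg h0.le]
      rw [lt_div_iff₀ (by positivity)] at h1
      nlinarith
    have h3 := hmin (w + ε • h) (by rw [ftmK_add, ftmK_smul, hh, hw, smul_zero, add_zero])
    have h4 := hL (w + ε • h) w ((norm_add_le _ _).trans (by linarith)) (by linarith)
    have h5 : ∫ t in (0:ℝ)..1, ‖ftmK (w + ε • h) t - ftmK w t‖ = ε * I := by
      rw [hI, ← intervalIntegral.integral_const_mul]
      congr 1 with t
      rw [ftmK_add, ftmK_smul, add_sub_cancel_left, norm_smul, Real.norm_of_nonneg h0.le]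
    rw [h5] at h4
    have h6 : ‖w + ε • h‖ ^ 2 = N + 2 * ε * b + ε ^ 2 * q := by
      rw [norm_add_sq_real, inner_smul_right, norm_smul, Real.norm_of_nonneg h0.le]
      ring
    have h7 : ftmF f x0 (w + ε • h) ≤ F + L * (ε * I) := by
      have := (abs_le.1 h4).2; linarith
    have h8 : N * F ≤ (N + 2 * ε * b + ε ^ 2 * q) * (F + L * (ε * I)) := by
      rw [← h6]
      exact h3.trans (mul_le_mul_of_nonneg_left h7 (sq_nonneg _))
    refine le_of_mul_le_mul_left ?_ h0
    nlinarith
  have hcont : Continuous fun ε : ℝ =>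
      2 * b * F + L * I * N + ε * (q * F + 2 * L * I * b + ε * (L * I * q)) := by fun_prop
  have := ge_of_tendsto ((hcont.tendsto 0).mono_left nhdsWithin_le_nhds) key
  simp only [zero_mul, add_zero] at this
  rw [div_mul_eq_mul_div, le_div_iff₀ (by positivity)]
  linarith

theorem ftm_real_inter {a τ t : ℝ} (ha : 0 ≤ a) (h1 : a + τ ≤ 1) :
    ftmMu.real (Set.Ioc a (a + τ) ∩ Set.Iic t) = max (min (a + τ) t - a) 0 := by
  have e : Set.Ioc a (a + τ) ∩ Set.Iic t = Set.Ioc a (min (a + τ) t) := by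
    ext x; simp only [Set.mem_inter_iff, Set.mem_Ioc, Set.mem_Iic, le_min_iff]; tauto
  have e2 : Set.Ioc a (min (a + τ) t) ∩ Set.Ioc 0 1 = Set.Ioc a (min (a + τ) t) := by
    apply Set.inter_eq_left.2
    intro x hx
    exact ⟨ha.trans_lt hx.1, hx.2.trans ((min_le_left _ _).trans h1)⟩
  rw [e, measureReal_def, Measure.restrict_apply measurableSet_Ioc, e2, Real.volume_Ioc,
    ENNReal.toReal_ofReal']

theorem ftm_slope (w : Lp E 2 ftmMu) (C : ℝ) (hC : 0 ≤ C)
    (hEL : ∀ h : Lp E 2 ftmMu, ftmK h 1 = 0 → - inner ℝ w h ≤ C * ∫ t in (0:ℝ)..1, ‖ftmK h t‖)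
    {s s' τ : ℝ} (hs : 0 ≤ s) (hss : s ≤ s') (hτ : 0 ≤ τ) (h1 : s' + τ ≤ 1) :
    ‖(∫ x in Set.Ioc s (s + τ), w x ∂ftmMu) - ∫ x in Set.Ioc s' (s' + τ), w x ∂ftmMu‖
      ≤ C * τ * (s' - s + τ) := by
  set D := (∫ x in Set.Ioc s (s + τ), w x ∂ftmMu) - ∫ x in Set.Ioc s' (s' + τ), w x ∂ftmMu with hD
  set h : Lp E 2 ftmMu := indicatorConstLp 2 (μ := ftmMu)
    (measurableSet_Ioc (a := s') (b := s' + τ)) (measure_ne_top _ _) D -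
    indicatorConstLp 2 (μ := ftmMu)
    (measurableSet_Ioc (a := s) (b := s + τ)) (measure_ne_top _ _) D with hh
  have hK : ∀ t, ftmK h t =
      (max (min (s' + τ) t - s') 0 - max (min (s + τ) t - s) 0) • D := by
    intro t
    rw [hh, ftmK_sub', ftmK, ftmK, setIntegral_indicatorConstLp measurableSet_Iic,
      setIntegral_indicatorConstLp measurableSet_Iic, ftm_real_inter (hs.trans hss) h1,
      ftm_real_inter hs (by linarith), sub_smul]
  have hin : - inner ℝ w h = ‖D‖ ^ 2 := by
    rw [hh, inner_sub_right, real_inner_comm, real_inner_comm (indicatorConstLp 2 _ _ D),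
      L2.inner_indicatorConstLp_eq_inner_setIntegral, L2.inner_indicatorConstLp_eq_inner_setIntegral,
      neg_sub, ← inner_sub_right, ← hD, real_inner_self_eq_norm_sq]
  have hlow : ∀ t, t ≤ s → ftmK h t = 0 := by
    intro t ht
    rw [hK, min_eq_right (by linarith), min_eq_right (by linarith), max_eq_right (by linarith),
      max_eq_right (by linarith), sub_self, zero_smul]
  have hhigh : ∀ t, s' + τ ≤ t → ftmK h t = 0 := by
    intro t ht
    rw [hK, min_eq_left (by linarith), min_eq_left (by linarith), max_eq_left (by linarith),
      max_eq_left (by linarith)]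
    simp
  have hmid : ∀ t, ‖ftmK h t‖ ≤ τ * ‖D‖ := by
    intro t
    rw [hK, norm_smul, Real.norm_eq_abs]
    refine mul_le_mul_of_nonneg_right ?_ (norm_nonneg _)
    have a1 : max (min (s' + τ) t - s') 0 ≤ τ :=
      max_le (by have := min_le_left (s' + τ) t; linarith) hτ
    have a2 : max (min (s + τ) t - s) 0 ≤ τ :=
      max_le (by have := min_le_left (s + τ) t; linarith) hτ
    have a3 := le_max_right (min (s' + τ) t - s') 0
    have a4 := le_max_right (min (s + τ) t - s) 0
    rw [abs_le]; constructor <;> linarith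
  have hEL' := hEL h (hhigh 1 h1)
  have hc : Continuous fun t => ‖ftmK h t‖ := (ftmK_cont h).norm
  have hsplit : ∫ t in (0:ℝ)..1, ‖ftmK h t‖ = ∫ t in s..(s' + τ), ‖ftmK h t‖ := by
    rw [← integral_add_adjacent_intervals (b := s) (hc.intervalIntegrable _ _) (hc.intervalIntegrable _ _),
      ← integral_add_adjacent_intervals (a := s) (b := s' + τ) (hc.intervalIntegrable _ _) (hc.intervalIntegrable _ _)]
    have z1 : ∫ t in (0:ℝ)..s, ‖ftmK h t‖ = 0 := by
      rw [integral_congr (g := fun _ => (0:ℝ)) ?_]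
      · simp
      · intro t ht
        rw [Set.uIcc_of_le hs] at ht
        simp [hlow t ht.2]
    have z2 : ∫ t in (s' + τ)..1, ‖ftmK h t‖ = 0 := by
      rw [integral_congr (g := fun _ => (0:ℝ)) ?_]
      · simp
      · intro t ht
        rw [Set.uIcc_of_le h1] at ht
        simp [hhigh t ht.1]
    rw [z1, z2]; ring
  have hb : ∫ t in s..(s' + τ), ‖ftmK h t‖ ≤ τ * ‖D‖ * (s' - s + τ) := by
    have : ∫ t in s..(s' + τ), ‖ftmK h t‖ ≤ ∫ t in s..(s' + τ), τ * ‖D‖ :=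
      integral_mono_on (by linarith) (hc.intervalIntegrable _ _) (by simp) (fun t _ => hmid t)
    rw [intervalIntegral.integral_const, smul_eq_mul] at this
    linarith
  rw [hin, hsplit] at hEL'
  have hfin : ‖D‖ ^ 2 ≤ C * (τ * ‖D‖ * (s' - s + τ)) :=
    hEL'.trans (mul_le_mul_of_nonneg_left hb hC)
  have hpos : 0 ≤ C * τ * (s' - s + τ) := mul_nonneg (mul_nonneg hC hτ) (by linarith)
  rcases eq_or_lt_of_le (norm_nonneg D) with h0 | h0
  · rw [← h0]; exact hpos
  · refine le_of_mul_le_mul_left ?_ h0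
    nlinarith

theorem ftm_reg (w : Lp E 2 ftmMu) (C : ℝ) (hC : 0 ≤ C)
    (hEL : ∀ h : Lp E 2 ftmMu, ftmK h 1 = 0 → - inner ℝ w h ≤ C * ∫ t in (0:ℝ)..1, ‖ftmK h t‖) :
    ∃ p : ℝ → E, Continuous p ∧ w =ᵐ[ftmMu] p := by
  have hii : IntervalIntegrable w volume 0 1 := by
    rw [intervalIntegrable_iff_integrableOn_Ioc_of_le zero_le_one]; exact ftm_int w
  have hae := hii.ae_hasDerivAt_integral
  set G : Set ℝ := {x | x ∈ Set.Ioo (0:ℝ) 1 ∧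
    HasDerivAt (fun y => ∫ t in x..y, w t) (w x) x} with hG
  have hslope : ∀ x ∈ G, Tendsto (fun τ : ℝ => τ⁻¹ • ∫ t in Set.Ioc x (x + τ), w t ∂ftmMu)
      (𝓝[>] 0) (𝓝 (w x)) := by
    rintro x ⟨hx, hd⟩
    refine hd.tendsto_slope_zero_right.congr' ?_
    have hev : ∀ᶠ τ in 𝓝[>] (0:ℝ), τ < 1 - x :=
      (eventually_lt_nhds (by linarith [hx.2])).filter_mono nhdsWithin_le_nhds
    filter_upwards [hev, self_mem_nhdsWithin] with τ h1 h0
    have h0 : 0 < τ := h0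
    rw [integral_same, sub_zero, integral_of_le (by linarith),
      Measure.restrict_restrict measurableSet_Ioc, Set.inter_eq_left.2]
    intro y hy
    exact ⟨hx.1.trans hy.1, by linarith [hy.2]⟩
  have hle : ∀ x ∈ G, ∀ y ∈ G, x ≤ y → ‖w x - w y‖ ≤ C * (y - x) := by
    intro x hx y hy hxy
    have hl := ((hslope x hx).sub (hslope y hy)).norm
    have hr : Tendsto (fun τ : ℝ => C * (y - x + τ)) (𝓝[>] 0) (𝓝 (C * (y - x))) := by
      have : Continuous fun τ : ℝ => C * (y - x + τ) := by fun_prop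
      simpa using (this.tendsto 0).mono_left nhdsWithin_le_nhds
    refine le_of_tendsto_of_tendsto hl hr ?_
    have hev : ∀ᶠ τ in 𝓝[>] (0:ℝ), τ < 1 - y :=
      (eventually_lt_nhds (by linarith [hy.1.2])).filter_mono nhdsWithin_le_nhds
    filter_upwards [hev, self_mem_nhdsWithin] with τ h1 h0
    have h0 : 0 < τ := h0
    have := ftm_slope w C hC hEL hx.1.1.le hxy h0.le (by linarith)
    rw [← smul_sub, norm_smul, norm_inv, Real.norm_of_nonneg h0.le, inv_mul_le_iff₀ h0]
    linarith
  have hlip : LipschitzOnWith (Real.toNNReal C) w G := by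
    refine LipschitzOnWith.of_dist_le_mul fun x hx y hy => ?_
    rw [Real.coe_toNNReal C hC, dist_eq_norm, Real.dist_eq]
    rcases le_total x y with hxy | hxy
    · rw [abs_of_nonpos (by linarith), neg_sub]; exact hle x hx y hy hxy
    · rw [abs_of_nonneg (by linarith), norm_sub_rev]; exact hle y hy x hx hxy
  obtain ⟨p, hp, hpe⟩ := hlip.extend_finite_dimension
  refine ⟨p, hp.continuous, ?_⟩
  rw [EventuallyEq, ae_restrict_iff' measurableSet_Ioc]
  have hne : ∀ᵐ x : ℝ, x ≠ 1 := by simp [ae_iff, measure_singleton]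
  filter_upwards [hae, hne] with x hx h1 hx01
  refine hpe ⟨⟨hx01.1, lt_of_le_of_ne hx01.2 h1⟩, ?_⟩
  have hm : x ∈ Set.uIcc (0:ℝ) 1 := by
    rw [Set.uIcc_of_le zero_le_one]; exact ⟨hx01.1.le, hx01.2⟩
  exact hx hm x hm

theorem ftm_lift (p : ℝ → E) (hp : Continuous p) :
    ∃ w : Lp E 2 ftmMu, w =ᵐ[ftmMu] p := by
  have hm : MemLp p 2 ftmMu := by
    obtain ⟨M, hM⟩ := (isCompact_Icc (a := (0:ℝ)) (b := 1)).exists_bound_of_continuousOn hp.continuousOn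
    refine MemLp.of_bound hp.aestronglyMeasurable M ?_
    rw [ae_restrict_iff' measurableSet_Ioc]
    exact Eventually.of_forall fun x hx => hM x ⟨hx.1.le, hx.2⟩
  exact ⟨hm.toLp p, hm.coeFn_toLp⟩

theorem ftm_K_eq (w : Lp E 2 ftmMu) (p : ℝ → E) (hw : w =ᵐ[ftmMu] p)
    {t : ℝ} (ht : t ∈ Set.Icc (0:ℝ) 1) : ftmK w t = ∫ s in (0:ℝ)..t, p s := by
  rw [ftmK, integral_congr_ae (ae_restrict_of_ae hw), Measure.restrict_restrict measurableSet_Iic,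
    integral_of_le ht.1]
  congr 2
  ext x; simp only [Set.mem_inter_iff, Set.mem_Ioc, Set.mem_Iic]
  have := ht.2
  grind

theorem ftm_norm_eq (w : Lp E 2 ftmMu) (p : ℝ → E) (hw : w =ᵐ[ftmMu] p) :
    ‖w‖ ^ 2 = ∫ s in (0:ℝ)..1, ‖p s‖ ^ 2 := by
  rw [← real_inner_self_eq_norm_sq, L2.inner_def, integral_of_le zero_le_one]
  refine integral_congr_ae ?_
  filter_upwards [hw] with x hx
  rw [hx, real_inner_self_eq_norm_sq]

/-- action of a `C¹` curve in terms of the rescaled velocity -/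
theorem ftm_action (U : E → ℝ) (hU : Continuous U) (k : ℝ) (γ : ℝ → E) (hγ : ContDiff ℝ 1 γ)
    (T : ℝ) (hT : 0 < T) (w : Lp E 2 ftmMu) (hw : w =ᵐ[ftmMu] fun s => T • deriv γ (T * s)) :
    ftmK w 1 = γ T - γ 0 ∧
    (∫ t in (0:ℝ)..T, ((1/2) * ‖deriv γ t‖^2 - U (γ t) + k)) =
      ‖w‖ ^ 2 / (2 * T) + T * ftmF (fun x => k - U x) (γ 0) w := by
  have hdc : Continuous (deriv γ) := hγ.continuous_deriv le_rfl
  have hdd : Differentiable ℝ γ := hγ.differentiable (by norm_num)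
  have hK : ∀ t ∈ Set.Icc (0:ℝ) 1, ftmK w t = γ (T * t) - γ 0 := by
    intro t ht
    rw [ftm_K_eq w _ hw ht]
    have := integral_eq_sub_of_hasDerivAt (a := 0) (b := t) (f := fun s => γ (T * s))
      (f' := fun s => T • deriv γ (T * s)) (fun x _ => ?_)
      ((continuous_const.smul (hdc.comp (by fun_prop))).intervalIntegrable _ _)
    · rw [this]; simp
    · have h1 := (hdd (T * x)).hasDerivAt
      have h2 : HasDerivAt (fun s : ℝ => T * s) T x := by
        simpa using (hasDerivAt_id x).const_mul T
      exact h1.scomp x h2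
  refine ⟨by simpa using hK 1 (by simp), ?_⟩
  have e1 := intervalIntegral.mul_integral_comp_mul_left (a := 0) (b := 1)
    (f := fun t => (1/2) * ‖deriv γ t‖^2 - U (γ t) + k) T
  rw [mul_zero, mul_one] at e1
  rw [← e1, ftm_norm_eq w _ hw, ftmF]
  have e2 : ∫ t in (0:ℝ)..1, k - U (γ 0 + ftmK w t) = ∫ t in (0:ℝ)..1, k - U (γ (T * t)) := by
    refine integral_congr fun t ht => ?_
    rw [Set.uIcc_of_le zero_le_one] at ht
    simp only [hK t ht, add_sub_cancel]
  have cA : Continuous fun t : ℝ => ‖deriv γ (T * t)‖ ^ 2 := (hdc.comp (by fun_prop)).norm.pow 2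
  have cB : Continuous fun t : ℝ => k - U (γ (T * t)) :=
    continuous_const.sub (hU.comp (hγ.continuous.comp (by fun_prop)))
  have e3 : ∫ t in (0:ℝ)..1, ‖T • deriv γ (T * t)‖ ^ 2 =
      T ^ 2 * ∫ t in (0:ℝ)..1, ‖deriv γ (T * t)‖ ^ 2 := by
    rw [← intervalIntegral.integral_const_mul]
    refine integral_congr fun t ht => ?_
    simp only [norm_smul, Real.norm_eq_abs, mul_pow, sq_abs]
  have e4 : ∫ t in (0:ℝ)..1, ((1/2) * ‖deriv γ (T * t)‖^2 - U (γ (T * t)) + k) =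
      (1/2) * (∫ t in (0:ℝ)..1, ‖deriv γ (T * t)‖^2) + ∫ t in (0:ℝ)..1, k - U (γ (T * t)) := by
    have cA' : Continuous fun t : ℝ => (1/2) * ‖deriv γ (T * t)‖ ^ 2 := by fun_prop
    rw [← intervalIntegral.integral_const_mul, ← intervalIntegral.integral_add
      (cA'.intervalIntegrable _ _) (cB.intervalIntegrable _ _)]
    refine integral_congr fun t ht => ?_
    ring
  rw [e2, e3, e4]
  field_simp

theorem ftm_main (U : E → ℝ)
    (hU : ContDiff ℝ 1 U) (hUbdd : BddAbove (Set.range U)) (k : ℝ)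
    (hk : sSup (Set.range U) < k) (xm xp : E) (hne : xm ≠ xp) :
    ∃ Tstar > (0:ℝ), ∃ γstar : ℝ → E,
      ContDiff ℝ 1 γstar ∧ γstar 0 = xm ∧ γstar Tstar = xp ∧
      ∀ T : ℝ, 0 < T → ∀ γ : ℝ → E,
        ContDiff ℝ 1 γ → γ 0 = xm → γ T = xp →
        (∫ t in (0:ℝ)..Tstar, ((1/2) * ‖deriv γstar t‖^2 - U (γstar t) + k))
          ≤ ∫ t in (0:ℝ)..T, ((1/2) * ‖deriv γ t‖^2 - U (γ t) + k) := by
  set f : E → ℝ := fun x => k - U x with hf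
  have hfd : ContDiff ℝ 1 f := contDiff_const.sub hU
  set c := k - sSup (Set.range U)
  have hc : 0 < c := sub_pos.2 hk
  have hfc : ∀ x, c ≤ f x := fun x => by
    have := le_csSup hUbdd (Set.mem_range_self x)
    simp only [hf, c]; linarith
  have hFc : ∀ w : Lp E 2 ftmMu, c ≤ ftmF f xm w := by
    intro w
    have : ∫ t in (0:ℝ)..1, c ≤ ftmF f xm w :=
      integral_mono_on zero_le_one (by simp)
        ((hfd.continuous.comp (continuous_const.add (ftmK_cont w))).intervalIntegrable _ _)
        (fun t _ => hfc _)
    simpa using this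
  obtain ⟨w, hw1, hmin⟩ := ftm_exists f hfd xm (xp - xm) c hc hfc
  have hF : 0 < ftmF f xm w := hc.trans_le (hFc w)
  obtain ⟨C, hC, hEL⟩ := ftm_EL f hfd xm (xp - xm) w hF hw1 hmin
  obtain ⟨p, hp, hwp⟩ := ftm_reg w C hC hEL
  have hwpos : 0 < ‖w‖ := by
    have h1 := ftmK_norm w (t := 1) (by simp)
    rw [hw1] at h1
    exact (norm_pos_iff.2 (sub_ne_zero.2 hne.symm)).trans_le h1
  set F := ftmF f xm w with hFdef
  set T := ‖w‖ / √(2 * F) with hTdef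
  have hT : 0 < T := by positivity
  have hT2 : ‖w‖ ^ 2 = 2 * F * T ^ 2 := by
    rw [hTdef, div_pow, Real.sq_sqrt (by positivity)]
    field_simp
  set γ : ℝ → E := fun t => xm + ∫ s in (0:ℝ)..(T⁻¹ * t), p s with hγ
  have hder : ∀ t, HasDerivAt γ (T⁻¹ • p (T⁻¹ * t)) t := by
    intro t
    have h1 : HasDerivAt (fun u => ∫ s in (0:ℝ)..u, p s) (p (T⁻¹ * t)) (T⁻¹ * t) :=
      integral_hasDerivAt_right (hp.intervalIntegrable _ _)
        (hp.stronglyMeasurableAtFilter _ _) hp.continuousAt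
    have h2 : HasDerivAt (fun s : ℝ => T⁻¹ * s) T⁻¹ t := by
      simpa using (hasDerivAt_id t).const_mul T⁻¹
    exact (h1.scomp t h2).const_add xm
  have hderiv : deriv γ = fun t => T⁻¹ • p (T⁻¹ * t) := funext fun t => (hder t).deriv
  have hγ1 : ContDiff ℝ 1 γ := by
    rw [contDiff_one_iff_deriv]
    refine ⟨fun t => (hder t).differentiableAt, ?_⟩
    rw [hderiv]
    exact continuous_const.smul (hp.comp (by fun_prop))
  have hγ0 : γ 0 = xm := by simp [hγ]
  have hwγ : w =ᵐ[ftmMu] fun s => T • deriv γ (T * s) := by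
    refine hwp.trans (Eventually.of_forall fun s => ?_)
    simp only [hderiv]
    rw [smul_smul, mul_inv_cancel₀ hT.ne', one_smul, inv_mul_cancel_left₀ hT.ne']
  obtain ⟨hA1, hA2⟩ := ftm_action U hU.continuous k γ hγ1 T hT w hwγ
  refine ⟨T, hT, γ, hγ1, hγ0, ?_, ?_⟩
  · rw [hw1, hγ0] at hA1
    exact (sub_left_injective hA1).symm
  intro T' hT' γ' hγ' h0 h1
  obtain ⟨w', hw'⟩ := ftm_lift (fun s => T' • deriv γ' (T' * s))
    (continuous_const.smul ((hγ'.continuous_deriv le_rfl).comp (by fun_prop)))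
  obtain ⟨hB1, hB2⟩ := ftm_action U hU.continuous k γ' hγ' T' hT' w' hw'
  rw [h0, h1] at hB1
  have hJ := hmin w' hB1
  rw [hA2, hB2, hγ0, h0]
  change ‖w‖ ^ 2 / (2 * T) + T * F ≤ ‖w'‖ ^ 2 / (2 * T') + T' * ftmF f xm w'
  have hF' : 0 < ftmF f xm w' := hc.trans_le (hFc w')
  set F' := ftmF f xm w'
  have l : ‖w‖ ^ 2 / (2 * T) + T * F = 2 * T * F := by rw [hT2]; field_simp; ring
  rw [l]
  set X := ‖w'‖ ^ 2 / (2 * T') with hX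
  have hX0 : 0 ≤ X := by positivity
  have hX' : ‖w'‖ ^ 2 = X * (2 * T') := by rw [hX]; field_simp
  refine abs_le_of_sq_le_sq' ?_ (by positivity) |>.2
  rw [hT2, hX'] at hJ
  nlinarith [sq_nonneg (X - T' * F')]

end FTM

/-- for every energy parameter `k` above the Mañé critical value `sup U`,
the free-time action admits a global minimizer among `C¹` curves joining `x₋` to `x₊`. -/
theorem exists_free_time_minimizer {n : ℕ} (U : EuclideanSpace ℝ (Fin n) → ℝ)
    (hU : ContDiff ℝ 2 U) (hUbdd : BddAbove (Set.range U)) (k : ℝ)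
    (hk : sSup (Set.range U) < k)
    (xm xp : EuclideanSpace ℝ (Fin n)) (hne : xm ≠ xp) :
    ∃ Tstar > (0:ℝ), ∃ γstar : ℝ → EuclideanSpace ℝ (Fin n),
      ContDiff ℝ 1 γstar ∧ γstar 0 = xm ∧ γstar Tstar = xp ∧
      ∀ T : ℝ, 0 < T → ∀ γ : ℝ → EuclideanSpace ℝ (Fin n),
        ContDiff ℝ 1 γ → γ 0 = xm → γ T = xp →
        (∫ t in (0:ℝ)..Tstar, ((1/2) * ‖deriv γstar t‖^2 - U (γstar t) + k))
          ≤ ∫ t in (0:ℝ)..T, ((1/2) * ‖deriv γ t‖^2 - U (γ t) + k) := by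
  exact ftm_main U (hU.of_le (by norm_num)) hUbdd k hk xm xp hne
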